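/- arXiv:2602.07800 — 2 statements merged into one kernel-verified Lean document; each statement's English description precedes it below -/
import Mathlib

section
/- Let 0 < δ < 1, let l be a positive natural number, and let M₁, …, M_l ≥ 1 be real numbers with M = ∏_{i=1}^{l} M_i. Then there exist universal constants c₁, c₂ > 0 (independent of δ, l, and the M_i) and a ReLU network χ : ℝ^l → ℝ of width at most c₁·l and depth at most c₂·(1 + log(l)·(log(l/δ) + log(M))) such that for all x = (x₁, …, x_l) ∈ ℝ^l with |x_i| ≤ M_i for every i, one has |∏_{i=1}^{l} x_i − χ(x)| ≤ δ. -/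
/-- The rectified linear unit `x ↦ max(x, 0)`. -/
def relu (x : ℝ) : ℝ := max x 0

/-- `IsReLUNet d₀ d L W f` says that `f : ℝ^{d₀} → ℝ^{d}` is realized by a ReLU network
`f = T_L ∘ σ ∘ T_{L−1} ∘ ⋯ ∘ σ ∘ T_1` of depth `L` (the number of affine maps) and width
`W = max_{0 ≤ i ≤ L} d_i`, where each `T_i : ℝ^{d_{i−1}} → ℝ^{d_i}` is affine and `σ`
applies the ReLU componentwise. -/
inductive IsReLUNet : (d₀ d L W : ℕ) → ((Fin d₀ → ℝ) → (Fin d → ℝ)) → Prop where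
  | affine {d₀ d₁ : ℕ} (A : Matrix (Fin d₁) (Fin d₀) ℝ) (b : Fin d₁ → ℝ) :
      IsReLUNet d₀ d₁ 1 (max d₀ d₁) (fun x => A.mulVec x + b)
  | comp {d₀ d d' L W : ℕ} {f : (Fin d₀ → ℝ) → (Fin d → ℝ)}
      (A : Matrix (Fin d') (Fin d) ℝ) (b : Fin d' → ℝ)
      (hf : IsReLUNet d₀ d L W f) :
      IsReLUNet d₀ d' (L + 1) (max W d') (fun x => A.mulVec (fun i => relu (f x i)) + b)

def GNet (l : ℕ) {κ : Type} (L W : ℕ) (f : (Fin l → ℝ) → (κ → ℝ)) : Prop :=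
  ∃ (d W' : ℕ) (e : κ ≃ Fin d) (f' : (Fin l → ℝ) → (Fin d → ℝ)),
    W' ≤ W ∧ IsReLUNet l d L W' f' ∧ ∀ x k, f x k = f' x (e k)

def Aff {κ : Type} [Fintype κ] (g : (κ → ℝ) → ℝ) : Prop :=
  ∃ (a : κ → ℝ) (b : ℝ), ∀ y, g y = (∑ k, a k * y k) + b

section AffLemmas
variable {κ : Type} [Fintype κ]

theorem Aff.coord (k : κ) : Aff (fun y : κ → ℝ => y k) := by
  classical
  exact ⟨fun j => if j = k then 1 else 0, 0, fun y => by simp⟩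

theorem Aff.const (c : ℝ) : Aff (fun _ : κ → ℝ => c) :=
  ⟨fun _ => 0, c, fun y => by simp⟩

theorem Aff.add {g h : (κ → ℝ) → ℝ} (hg : Aff g) (hh : Aff h) : Aff (fun y => g y + h y) := by
  obtain ⟨a, b, H⟩ := hg
  obtain ⟨a', b', H'⟩ := hh
  refine ⟨fun k => a k + a' k, b + b', fun y => ?_⟩
  simp only [H, H', add_mul, Finset.sum_add_distrib]
  ring

theorem Aff.smul {g : (κ → ℝ) → ℝ} (c : ℝ) (hg : Aff g) : Aff (fun y => c * g y) := by
  obtain ⟨a, b, H⟩ := hg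
  refine ⟨fun k => c * a k, c * b, fun y => ?_⟩
  simp only [H, mul_add, Finset.mul_sum, mul_assoc]

theorem Aff.sub {g h : (κ → ℝ) → ℝ} (hg : Aff g) (hh : Aff h) : Aff (fun y => g y - h y) := by
  have := hg.add (hh.smul (-1))
  refine this.imp fun a h => h.imp fun b h y => ?_
  rw [← h y]; ring

end AffLemmas

theorem IsReLUNet.post {l d d' L W : ℕ} {f : (Fin l → ℝ) → (Fin d → ℝ)}
    (hf : IsReLUNet l d L W f) (A : Matrix (Fin d') (Fin d) ℝ) (b : Fin d' → ℝ) :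
    ∃ W', W' ≤ max W d' ∧ IsReLUNet l d' L W' (fun x => A.mulVec (f x) + b) := by
  cases hf with
  | affine A' b' =>
    refine ⟨max l d', ?_, ?_⟩
    rotate_left
    · have := IsReLUNet.affine (A * A') (A.mulVec b' + b)
      convert this using 2 with x
      rw [Matrix.mulVec_add, Matrix.mulVec_mulVec, add_assoc]
    · omega
  | @comp _ _ _ W₀ _ A' b' h =>
    refine ⟨max W₀ d', ?_, ?_⟩
    rotate_left
    · have := IsReLUNet.comp (A * A') (A.mulVec b' + b) h
      convert this using 2 with x
      rw [Matrix.mulVec_add, Matrix.mulVec_mulVec, add_assoc]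
    · omega

theorem aff_matrix {κ κ' : Type} [Fintype κ] {d d' : ℕ} (e : κ ≃ Fin d) (e' : κ' ≃ Fin d')
    (g : κ' → (κ → ℝ) → ℝ) (hg : ∀ k, Aff (g k)) :
    ∃ (A : Matrix (Fin d') (Fin d) ℝ) (b : Fin d' → ℝ), ∀ (y : Fin d → ℝ) (k : κ'),
      g k (fun i => y (e i)) = (A.mulVec y + b) (e' k) := by
  choose a b H using hg
  refine ⟨fun i j => a (e'.symm i) (e.symm j), fun i => b (e'.symm i), fun y k => ?_⟩
  rw [H]
  simp only [Pi.add_apply, Matrix.mulVec, dotProduct, Equiv.symm_apply_apply, add_left_inj]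
  exact Fintype.sum_equiv e _ _ (fun i => by simp)

section NetLemmas
variable {l L W : ℕ} {κ κ' : Type} [Fintype κ] [Fintype κ']

theorem GNet.start (g : κ → (Fin l → ℝ) → ℝ) (hg : ∀ k, Aff (g k)) (hl : l ≤ W)
    (hW : Fintype.card κ ≤ W) : GNet l 1 W (fun x k => g k x) := by
  obtain ⟨A, b, H⟩ := aff_matrix (Equiv.refl (Fin l)) (Fintype.equivFin κ) g hg
  exact ⟨_, _, Fintype.equivFin κ, _, max_le hl hW, IsReLUNet.affine A b, fun x k => H x k⟩

theorem GNet.post {f : (Fin l → ℝ) → (κ → ℝ)} (hf : GNet l L W f)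
    (g : κ' → (κ → ℝ) → ℝ) (hg : ∀ k, Aff (g k))
    (hW : Fintype.card κ' ≤ W) : GNet l L W (fun x k => g k (f x)) := by
  obtain ⟨d, W', e, f', hW', hn, hf'⟩ := hf
  obtain ⟨A, b, H⟩ := aff_matrix e (Fintype.equivFin κ') g hg
  obtain ⟨W'', h1, h2⟩ := hn.post A b
  refine ⟨_, _, Fintype.equivFin κ', _, h1.trans (max_le hW' hW), h2, fun x k => ?_⟩
  rw [← H]
  refine congrArg (g k) ?_
  funext i
  exact hf' x i

theorem GNet.act {f : (Fin l → ℝ) → (κ → ℝ)} (hf : GNet l L W f)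
    (g : κ' → (κ → ℝ) → ℝ) (hg : ∀ k, Aff (g k))
    (hW : Fintype.card κ' ≤ W) : GNet l (L + 1) W (fun x k => g k (fun i => relu (f x i))) := by
  obtain ⟨d, W', e, f', hW', hn, hf'⟩ := hf
  obtain ⟨A, b, H⟩ := aff_matrix e (Fintype.equivFin κ') g hg
  refine ⟨_, _, Fintype.equivFin κ', _, max_le hW' hW, IsReLUNet.comp A b hn, fun x k => ?_⟩
  rw [← H]
  refine congrArg (g k) ?_
  funext i
  rw [hf' x i]

end NetLemmas

/-- The tooth function on `[0,1]`. -/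
noncomputable def tooth (p : ℝ) : ℝ := 2 * relu p - 4 * relu (p - 1 / 2)

noncomputable def sqp : ℕ → ℝ → ℝ
  | 0, t => t
  | n + 1, t => tooth (sqp n t)

noncomputable def sqF : ℕ → ℝ → ℝ
  | 0, t => t
  | n + 1, t => relu (sqF n t) - (1 / 4 ^ (n + 1)) * tooth (sqp n t)

theorem tooth_spec {p : ℝ} (h0 : 0 ≤ p) (h1 : p ≤ 1) :
    0 ≤ tooth p ∧ tooth p ≤ 1 ∧ p - p ^ 2 = tooth p / 4 + (tooth p - tooth p ^ 2) / 4 := by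
  unfold tooth relu
  rw [max_eq_left h0]
  rcases le_total p (1 / 2) with h | h
  · rw [max_eq_right (by linarith)]
    refine ⟨by linarith, by linarith, by ring⟩
  · rw [max_eq_left (by linarith)]
    refine ⟨by linarith, by linarith, by ring⟩

theorem sq_inv {t : ℝ} (h0 : 0 ≤ t) (h1 : t ≤ 1) (n : ℕ) :
    (0 ≤ sqp n t ∧ sqp n t ≤ 1) ∧ (0 ≤ sqF n t ∧ sqF n t ≤ 1) ∧
      sqF n t = t ^ 2 + (1 / 4 ^ n) * (sqp n t - sqp n t ^ 2) := by
  induction n with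
  | zero => simp [sqp, sqF, h0, h1]
  | succ n ih =>
    obtain ⟨⟨hp0, hp1⟩, ⟨hF0, hF1⟩, hE⟩ := ih
    obtain ⟨ht0, ht1, hte⟩ := tooth_spec hp0 hp1
    have hpos : (0 : ℝ) < 1 / 4 ^ (n + 1) := by positivity
    have key : sqF (n + 1) t
        = t ^ 2 + (1 / 4 ^ (n + 1)) * (sqp (n + 1) t - sqp (n + 1) t ^ 2) := by
      simp only [sqF, sqp]
      rw [relu, max_eq_left hF0, hE, hte, pow_succ]
      field_simp
      ring
    refine ⟨⟨ht0, ht1⟩, ⟨?_, ?_⟩, key⟩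
    · rw [key]
      have : 0 ≤ sqp (n + 1) t - sqp (n + 1) t ^ 2 := by
        simp only [sqp]
        nlinarith
      positivity
    · simp only [sqF]
      rw [relu, max_eq_left hF0]
      have := mul_nonneg hpos.le ht0
      linarith

theorem sqF_err {t : ℝ} (h0 : 0 ≤ t) (h1 : t ≤ 1) (n : ℕ) :
    0 ≤ sqF n t - t ^ 2 ∧ sqF n t - t ^ 2 ≤ 1 / 4 ^ n := by
  obtain ⟨⟨hp0, hp1⟩, -, hE⟩ := sq_inv h0 h1 n
  have hpos : (0 : ℝ) < 1 / 4 ^ n := by positivity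
  rw [hE]
  constructor
  · have : 0 ≤ sqp n t - sqp n t ^ 2 := by nlinarith
    have := mul_nonneg hpos.le this
    linarith
  · have : sqp n t - sqp n t ^ 2 ≤ 1 := by nlinarith
    have := mul_le_mul_of_nonneg_left this hpos.le
    linarith

theorem GNet.sq {l L W : ℕ} {ι : Type} [Fintype ι] {f : (Fin l → ℝ) → (ι → ℝ)}
    (hf : GNet l L W f) (hW : 3 * Fintype.card ι ≤ W) (n : ℕ) :
    GNet l (L + n) W (fun x i => sqF n (f x i)) := by
  have main : GNet l (L + n) W
      (fun x (k : ι × Fin 2) => ![sqp n (f x k.1), sqF n (f x k.1)] k.2) := by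
    induction n with
    | zero =>
      have := hf.post (κ' := ι × Fin 2) (fun k y => y k.1) (fun k => Aff.coord _)
        (by simp; omega)
      rw [Nat.add_zero]
      convert this using 1
      funext x k
      obtain ⟨i, c⟩ := k
      fin_cases c <;> simp [sqp, sqF]
    | succ n ih =>
      have h1 := ih.post (κ' := ι × Fin 3)
        (fun k y => ![y (k.1, 0), y (k.1, 0) - 1 / 2, y (k.1, 1)] k.2)
        (by
          rintro ⟨i, c⟩
          fin_cases c
          · exact Aff.coord _
          · exact (Aff.coord _).sub (Aff.const _)
          · exact Aff.coord _) (by simp; omega)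
      have h2 := h1.act (κ' := ι × Fin 2)
        (fun k y => ![2 * y (k.1, 0) - 4 * y (k.1, 1),
          y (k.1, 2) - (1 / 4 ^ (n + 1)) * (2 * y (k.1, 0) - 4 * y (k.1, 1))] k.2)
        (by
          rintro ⟨i, c⟩
          have := ((Aff.coord ((i, 0) : ι × Fin 3)).smul 2).sub
            ((Aff.coord ((i, 1) : ι × Fin 3)).smul 4)
          fin_cases c
          · exact this
          · exact (Aff.coord ((i, 2) : ι × Fin 3)).sub (this.smul _)) (by simp; omega)
      rw [← Nat.add_assoc]
      convert h2 using 1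
      funext x k
      obtain ⟨i, c⟩ := k
      fin_cases c <;> simp [sqp, sqF, tooth]
  have := main.post (κ' := ι) (fun i y => y (i, 1)) (fun k => Aff.coord _) (by omega)
  simpa using this

theorem relu_abs (t : ℝ) : relu t + relu (-t) = |t| := by
  unfold relu
  rcases le_total t 0 with h | h
  · rw [max_eq_right h, max_eq_left (by linarith), abs_of_nonpos h]; ring
  · rw [max_eq_left h, max_eq_right (by linarith), abs_of_nonneg h]; ring

noncomputable def mulN (n : ℕ) (u v : ℝ) : ℝ := sqF n |(u + v) / 2| - sqF n |(u - v) / 2|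

theorem mulN_spec (n : ℕ) {u v : ℝ} (hu : |u| ≤ 1) (hv : |v| ≤ 1) :
    |mulN n u v| ≤ 1 ∧ |u * v - mulN n u v| ≤ 1 / 4 ^ n := by
  rw [abs_le] at hu hv
  have ha : |(u + v) / 2| ≤ 1 := abs_le.2 ⟨by linarith, by linarith⟩
  have hb : |(u - v) / 2| ≤ 1 := abs_le.2 ⟨by linarith, by linarith⟩
  have h1 := sqF_err (abs_nonneg _) ha n
  have h2 := sqF_err (abs_nonneg _) hb n
  have h3 := (sq_inv (abs_nonneg _) ha n).2.1
  have h4 := (sq_inv (abs_nonneg _) hb n).2.1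
  rw [sq_abs] at h1 h2
  have : u * v = ((u + v) / 2) ^ 2 - ((u - v) / 2) ^ 2 := by ring
  unfold mulN
  rw [this]
  constructor <;> rw [abs_le] <;> constructor <;> linarith

theorem GNet.mul {l L W : ℕ} {ι κ : Type} [Fintype ι] [Fintype κ] {f : (Fin l → ℝ) → (κ → ℝ)}
    (hf : GNet l L W f) (a b : ι → κ) (hW : 6 * Fintype.card ι ≤ W) (n : ℕ) :
    GNet l (L + (n + 1)) W (fun x i => mulN n (f x (a i)) (f x (b i))) := by
  have h1 := hf.post (κ' := ι × Fin 4)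
    (fun k y => ![(1 / 2) * (y (a k.1) + y (b k.1)), (-1 / 2) * (y (a k.1) + y (b k.1)),
      (1 / 2) * (y (a k.1) - y (b k.1)), (-1 / 2) * (y (a k.1) - y (b k.1))] k.2)
    (by
      rintro ⟨i, c⟩
      fin_cases c
      · exact ((Aff.coord _).add (Aff.coord _)).smul _
      · exact ((Aff.coord _).add (Aff.coord _)).smul _
      · exact ((Aff.coord _).sub (Aff.coord _)).smul _
      · exact ((Aff.coord _).sub (Aff.coord _)).smul _) (by simp; omega)
  have h2 := h1.act (κ' := ι × Fin 2)
    (fun k y => ![y (k.1, 0) + y (k.1, 1), y (k.1, 2) + y (k.1, 3)] k.2)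
    (by
      rintro ⟨i, c⟩
      fin_cases c
      · exact (Aff.coord _).add (Aff.coord _)
      · exact (Aff.coord _).add (Aff.coord _)) (by simp; omega)
  have h3 := h2.sq (by simp; omega) n
  have h4 := h3.post (κ' := ι) (fun i y => y (i, 0) - y (i, 1))
    (fun i => (Aff.coord _).sub (Aff.coord _)) (by omega)
  have e : L + 1 + n = L + (n + 1) := by omega
  rw [e] at h4
  convert h4 using 1
  funext x i
  simp only [mulN, ← relu_abs]
  simp
  congr 3 <;> congr 1 <;> ring

theorem prod_lip {ι : Type} (s : Finset ι) (a b : ι → ℝ) (ε : ℝ) (ha : ∀ i, |a i| ≤ 1)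
    (hb : ∀ i, |b i| ≤ 1) (h : ∀ i, |a i - b i| ≤ ε) :
    |∏ i ∈ s, a i - ∏ i ∈ s, b i| ≤ s.card * ε := by
  classical
  induction s using Finset.induction_on with
  | empty => simp
  | insert i s hi ih =>
    rw [Finset.prod_insert hi, Finset.prod_insert hi, Finset.card_insert_of_notMem hi]
    have e : a i * ∏ i ∈ s, a i - b i * ∏ i ∈ s, b i
      = a i * (∏ i ∈ s, a i - ∏ i ∈ s, b i) + (a i - b i) * ∏ i ∈ s, b i := by ring
    rw [e]
    have hp : |∏ i ∈ s, b i| ≤ 1 := by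
      rw [Finset.abs_prod]
      exact Finset.prod_le_one (fun _ _ => abs_nonneg _) (fun i _ => hb i)
    refine (abs_add_le _ _).trans ?_
    rw [abs_mul, abs_mul]
    have h1 := mul_le_mul (ha i) ih (abs_nonneg _) zero_le_one
    have h2 := mul_le_mul (h i) hp (abs_nonneg _) ((abs_nonneg _).trans (h i))
    push_cast
    linarith

theorem GNet.tree {l W n : ℕ} (k : ℕ) : ∀ {L : ℕ} {f : (Fin l → ℝ) → (Fin (2 ^ k) → ℝ)},
    GNet l L W f → 6 * 2 ^ k ≤ W →
    ∃ g : (Fin l → ℝ) → (Fin 1 → ℝ), GNet l (L + k * (n + 1)) W g ∧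
      ∀ x, (∀ i, |f x i| ≤ 1) → |∏ i, f x i - g x 0| ≤ ((2 : ℝ) ^ k - 1) * (1 / 4 ^ n) := by
  induction k with
  | zero =>
    intro L f hf hW
    exact ⟨f, by simpa using hf, fun x hx => by simp⟩
  | succ k ih =>
    intro L f hf hW
    let e : Fin (2 ^ k) × Bool ≃ Fin (2 ^ (k + 1)) :=
      Fintype.equivOfCardEq (by simp [pow_succ])
    have h1 := hf.mul (fun i => e (i, true)) (fun i => e (i, false))
      (by rw [pow_succ] at hW; simp; omega) n
    obtain ⟨g, hg, H⟩ := ih h1 (by rw [pow_succ] at hW; omega)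
    refine ⟨g, ?_, fun x hx => ?_⟩
    · convert hg using 1
      ring
    · have H1 := H x (fun i => (mulN_spec n (hx _) (hx _)).1)
      have H2 := prod_lip Finset.univ (fun i => f x (e (i, true)) * f x (e (i, false)))
        (fun i => mulN n (f x (e (i, true))) (f x (e (i, false)))) (1 / 4 ^ n)
        (fun i => by
          rw [abs_mul]
          exact mul_le_one₀ (hx _) (abs_nonneg _) (hx _))
        (fun i => (mulN_spec n (hx _) (hx _)).1) (fun i => (mulN_spec n (hx _) (hx _)).2)
      have H3 : ∏ i, f x i = ∏ i, f x (e (i, true)) * f x (e (i, false)) := by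
        rw [← Equiv.prod_comp e, Fintype.prod_prod_type]
        simp
      rw [H3]
      refine (abs_sub_le _ _ _).trans ((add_le_add H2 H1).trans (le_of_eq ?_))
      simp [pow_succ]
      ring

/-- **Approximate multiplication by ReLU networks.**
There are universal constants `c₁, c₂ > 0` such that for every `0 < δ < 1`, every `l ≥ 1`,
and all reals `M₁, …, M_l ≥ 1` with `M = ∏ᵢ Mᵢ`, there is a ReLU network `χ : ℝ^l → ℝ` of
width at most `c₁·l` and depth at most `c₂·(1 + log l · (log(l/δ) + log M))` with
`|∏ᵢ xᵢ − χ(x)| ≤ δ` whenever `|xᵢ| ≤ Mᵢ` for every `i`. -/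
theorem relu_net_approx_multiplication :
    ∃ c₁ c₂ : ℝ, 0 < c₁ ∧ 0 < c₂ ∧
      ∀ (δ : ℝ), 0 < δ → δ < 1 →
      ∀ (l : ℕ), 1 ≤ l →
      ∀ (M : Fin l → ℝ), (∀ i, 1 ≤ M i) →
        ∃ (L W : ℕ) (χ : (Fin l → ℝ) → (Fin 1 → ℝ)),
          IsReLUNet l 1 L W χ ∧
          (W : ℝ) ≤ c₁ * l ∧
          (L : ℝ) ≤ c₂ * (1 + Real.log l * (Real.log (l / δ) + Real.log (∏ i, M i))) ∧
          ∀ x : Fin l → ℝ, (∀ i, |x i| ≤ M i) →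
            |(∏ i, x i) - χ x 0| ≤ δ := by
  refine ⟨12, 28, by norm_num, by norm_num, ?_⟩
  intro δ hδ0 hδ1 l hl M hM
  have hlR : (1 : ℝ) ≤ l := by exact_mod_cast hl
  set P : ℝ := ∏ i, M i with hP
  have hP1 : 1 ≤ P := by
    rw [hP]
    calc (1 : ℝ) = ∏ i : Fin l, (1 : ℝ) := by simp
      _ ≤ _ := Finset.prod_le_prod (fun _ _ => zero_le_one) (fun i _ => hM i)
  set K := Nat.clog 2 l with hK
  have hK1 : l ≤ 2 ^ K := Nat.le_pow_clog (by norm_num) l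
  have hK2 : 2 ^ K ≤ 2 * l := by
    rcases Nat.lt_or_ge 1 l with h | h
    · have h1 := Nat.pow_pred_clog_lt_self (b := 2) (by norm_num) h
      have h2 : 0 < K := Nat.clog_pos (by norm_num) h
      rw [← hK] at h1
      obtain ⟨m, hm⟩ : ∃ m, K = m + 1 := ⟨K - 1, by omega⟩
      rw [hm] at h1 ⊢
      simp only [Nat.pred_eq_sub_one, Nat.add_sub_cancel] at h1
      rw [pow_succ]
      omega
    · have : l = 1 := by omega
      subst this
      simp [hK]
  set n := ⌈Real.log (2 * l * P / δ)⌉₊ with hn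
  have hn1 : 2 * l * P / δ ≤ 4 ^ n := by
    have hpos : 0 < 2 * l * P / δ := by positivity
    calc 2 * l * P / δ = Real.exp (Real.log (2 * l * P / δ)) := (Real.exp_log hpos).symm
      _ ≤ Real.exp n := Real.exp_le_exp.2 (Nat.le_ceil _)
      _ = Real.exp 1 ^ n := by rw [← Real.exp_nat_mul, mul_one]
      _ ≤ 4 ^ n := by
        have := Real.exp_one_lt_d9
        exact pow_le_pow_left₀ (Real.exp_pos 1).le (by linarith) n
  have h0 : GNet l 1 (12 * l) (fun x (k : Fin (2 ^ K)) =>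
      if h : (k : ℕ) < l then (1 / M ⟨k, h⟩) * x ⟨k, h⟩ else 1) := by
    refine GNet.start (fun (k : Fin (2 ^ K)) (x : Fin l → ℝ) =>
      if h : (k : ℕ) < l then (1 / M ⟨k, h⟩) * x ⟨k, h⟩ else 1) ?_ (by omega) (by simp; omega)
    intro k
    by_cases h : (k : ℕ) < l
    · simp only [h, dif_pos]
      exact (Aff.coord _).smul _
    · simp only [h, dif_neg, not_false_eq_true]
      exact Aff.const _
  obtain ⟨g, hg, H⟩ := GNet.tree (n := n) K h0 (by omega)
  obtain ⟨d, W, e, χ, hW, hnet, hχ⟩ := hg.post (κ' := Fin 1) (fun k y => P * y 0)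
    (fun k => (Aff.coord _).smul _) (by simp; omega)
  have hd : d = 1 := by simpa using (Fintype.card_congr e).symm
  subst hd
  refine ⟨_, W, χ, hnet, by exact_mod_cast hW, ?_, ?_⟩
  · rcases Nat.lt_or_ge 1 l with h | h
    · have hl2 : (2 : ℝ) ≤ l := by exact_mod_cast h
      have hlog2 : (1 / 2 : ℝ) ≤ Real.log 2 := by linarith [Real.log_two_gt_d9]
      have hlogl : Real.log 2 ≤ Real.log l := Real.log_le_log (by norm_num) hl2
      have hlogP : 0 ≤ Real.log P := Real.log_nonneg hP1
      have hlogδ : Real.log δ ≤ 0 := Real.log_nonpos hδ0.le hδ1.le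
      have e1 : Real.log (l / δ) = Real.log l - Real.log δ :=
        Real.log_div (by positivity) hδ0.ne'
      have e2 : Real.log (2 * l * P / δ)
          = Real.log 2 + Real.log l + Real.log P - Real.log δ := by
        rw [Real.log_div (by positivity) hδ0.ne', Real.log_mul (by positivity) (by positivity),
          Real.log_mul (by positivity) (by positivity)]
      have hn2 : (n : ℝ) < Real.log (2 * l * P / δ) + 1 :=
        Nat.ceil_lt_add_one (by rw [e2]; linarith)
      have hK3 : (K : ℝ) * Real.log 2 ≤ Real.log 2 + Real.log l := by
        rw [← Real.log_pow, ← Real.log_mul (by norm_num) (by positivity)]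
        exact Real.log_le_log (by positivity) (by exact_mod_cast hK2)
      have hKn : (0 : ℝ) ≤ K := Nat.cast_nonneg K
      have hK4 : (K : ℝ) ≤ 4 * Real.log l := by nlinarith
      have hlt := Real.log_two_lt_d9
      have hn3 : (n : ℝ) + 1 ≤ 7 * (Real.log (l / δ) + Real.log P) := by
        rw [e2] at hn2
        rw [e1]
        linarith
      have := mul_le_mul hK4 hn3 (by positivity) (by linarith)
      push_cast
      linarith
    · have : l = 1 := by omega
      subst this
      simp [hK]
  · intro x hx
    have hχ0 : χ x 0 = P * g x 0 := by
      have := hχ x 0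
      rw [Subsingleton.elim (e 0) 0] at this
      exact this.symm
    have H1 := H x (fun i => by
      split_ifs with h
      · rw [abs_mul, abs_of_pos (by have := hM ⟨i, h⟩; positivity), one_div,
          inv_mul_le_iff₀ (by linarith [hM ⟨i, h⟩]), mul_one]
        exact hx _
      · simp)
    have H2 : ∏ i, x i = P * ∏ k : Fin (2 ^ K),
        (if h : (k : ℕ) < l then (1 / M ⟨k, h⟩) * x ⟨k, h⟩ else 1) := by
      have F1 := Fin.prod_univ_eq_prod_range
        (fun k : ℕ => if h : k < l then (1 / M ⟨k, h⟩) * x ⟨k, h⟩ else 1) (2 ^ K)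
      have F2 := Fin.prod_univ_eq_prod_range
        (fun k : ℕ => if h : k < l then (1 / M ⟨k, h⟩) * x ⟨k, h⟩ else 1) l
      have F3 : ∏ k ∈ Finset.range l,
            (if h : k < l then (1 / M ⟨k, h⟩) * x ⟨k, h⟩ else 1)
          = ∏ k ∈ Finset.range (2 ^ K),
            (if h : k < l then (1 / M ⟨k, h⟩) * x ⟨k, h⟩ else 1) := by
        apply Finset.prod_subset
        · intro k hk
          simp only [Finset.mem_range] at hk ⊢
          omega
        · intro k _ hk
          rw [dif_neg (by simpa using hk)]
      rw [F1, ← F3, ← F2, hP, ← Finset.prod_mul_distrib]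
      refine Finset.prod_congr rfl fun i _ => ?_
      have : M i ≠ 0 := (lt_of_lt_of_le one_pos (hM i)).ne'
      simp [this]
    rw [hχ0, H2, ← mul_sub, abs_mul, abs_of_pos (by linarith)]
    have hK2R : (2 : ℝ) ^ K ≤ 2 * l := by exact_mod_cast hK2
    have h4 : (0 : ℝ) < 4 ^ n := by positivity
    rw [div_le_iff₀ hδ0] at hn1
    refine (mul_le_mul_of_nonneg_left H1 (by linarith)).trans ?_
    rw [mul_one_div, ← mul_div_assoc, div_le_iff₀ h4]
    nlinarith
end

section
/- Let x > 0 be a real number and K a natural number with K ≥ 2·e·x − 1. Then the tail of the exponential series satisfies ∑_{k=K+1}^{∞} x^k/k! ≤ (1/√(2π)) · (1/2)^{K+1} · e^{x}. -/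
/-- **Tail bound for the exponential series.**
For a real `x > 0` and a natural number `K` with `K ≥ 2·e·x − 1`, the tail
`∑_{k=K+1}^{∞} x^k / k!` of the exponential series satisfies
`∑_{k=K+1}^{∞} x^k / k! ≤ (1/√(2π)) · (1/2)^{K+1} · e^x`. -/
theorem exp_series_tail_bound (x : ℝ) (hx : 0 < x) (K : ℕ)
    (hK : (K : ℝ) ≥ 2 * Real.exp 1 * x - 1) :
    ∑' m : ℕ, x ^ (K + 1 + m) / (Nat.factorial (K + 1 + m) : ℝ) ≤
      (1 / Real.sqrt (2 * Real.pi)) * (1 / 2) ^ (K + 1) * Real.exp x := by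
  have hsum : Summable (fun m : ℕ => x ^ m / (Nat.factorial m : ℝ)) :=
    Real.summable_pow_div_factorial x
  have hexp : ∑' m : ℕ, x ^ m / (Nat.factorial m : ℝ) = Real.exp x := by
    rw [Real.exp_eq_exp_ℝ, NormedSpace.exp_eq_tsum_div]
  obtain ⟨n, hn⟩ : ∃ n, n = K + 1 := ⟨_, rfl⟩
  have hnx : 2 * Real.exp 1 * x ≤ (n : ℝ) := by rw [hn]; push_cast; linarith
  have hn1 : (1 : ℝ) ≤ n := by rw [hn]; push_cast; linarith [Nat.cast_nonneg (α := ℝ) K]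
  rw [← hn]
  have hterm : ∀ m : ℕ, x ^ (n + m) / (Nat.factorial (n + m) : ℝ) ≤
      x ^ n / (Nat.factorial n : ℝ) * (x ^ m / (Nat.factorial m : ℝ)) := by
    intro m
    have h1 : (Nat.factorial n : ℝ) * (Nat.factorial m : ℝ) ≤ (Nat.factorial (n + m) : ℝ) := by
      exact_mod_cast Nat.le_of_dvd (Nat.factorial_pos _) (Nat.factorial_mul_factorial_dvd_factorial_add n m)
    rw [div_mul_div_comm, ← pow_add]
    have := Nat.factorial_pos n
    have := Nat.factorial_pos m
    exact div_le_div_of_nonneg_left (by positivity) (by positivity) h1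
  have hs2 := hsum.mul_left (x ^ n / (Nat.factorial n : ℝ))
  have hs1 : Summable (fun m : ℕ => x ^ (n + m) / (Nat.factorial (n + m) : ℝ)) :=
    Summable.of_nonneg_of_le (fun m => by positivity) hterm hs2
  have hle := hs1.tsum_le_tsum hterm hs2
  rw [tsum_mul_left, hexp] at hle
  refine hle.trans (mul_le_mul_of_nonneg_right ?_ (Real.exp_pos x).le)
  have hst := Stirling.le_factorial_stirling n
  have hsq : Real.sqrt (2 * Real.pi) ≤ Real.sqrt (2 * Real.pi * n) :=
    Real.sqrt_le_sqrt (le_mul_of_one_le_right (by positivity) hn1)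
  have hxe : x ≤ 1 / 2 * (n / Real.exp 1) := by
    rw [← mul_div_assoc, le_div_iff₀ (Real.exp_pos 1)]
    linarith
  have hpow : x ^ n ≤ (1 / 2) ^ n * (n / Real.exp 1) ^ n := by
    rw [← mul_pow]
    exact pow_le_pow_left₀ hx.le hxe n
  have hs0 : 0 < Real.sqrt (2 * Real.pi) := by positivity
  have hfac : (n / Real.exp 1) ^ n ≤ 1 / Real.sqrt (2 * Real.pi) * (Nat.factorial n : ℝ) := by
    rw [one_div_mul_eq_div, le_div_iff₀ hs0, mul_comm]
    exact (mul_le_mul_of_nonneg_right hsq (by positivity)).trans hst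
  rw [div_le_iff₀ (by positivity)]
  calc x ^ n ≤ (1 / 2) ^ n * (n / Real.exp 1) ^ n := hpow
    _ ≤ (1 / 2) ^ n * (1 / Real.sqrt (2 * Real.pi) * (Nat.factorial n : ℝ)) :=
      mul_le_mul_of_nonneg_left hfac (by positivity)
    _ = _ := by ring
end
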